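/- Fix a positive odd integer h and an integer r such that gcd(r,h) is squarefree, and let t be an integer with gcd(t²−r, h) = 1. Define C_t = Σ_{d ≥ 1 odd, gcd(d,t)=1, gcd(d²,h) | r} μ(d) · Σ_{n ≥ 1 odd, gcd(n,d)=1} c_t(n) / ( n · φ(lcm(n·d², h)) ), where both series converge absolutely. Then C_t = P(r,h) · ∏_{p odd prime, p | t, p ∤ h} ( 1 + (2p²+p−1)/(p⁴−p³−2p²−p+1) ). -/

import Mathlib

open scoped Classical

noncomputable section

/-- The character sum `c_t(n) = Σ_{α mod n, (t²-α,n)=1, α ≡ r mod (n,h)} (α|n)`. -/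
noncomputable def cFun (r : ℤ) (h : ℕ) (t : ℤ) (n : ℕ) : ℤ :=
  ∑ α ∈ (Finset.range n).filter
      (fun α => Int.gcd (t ^ 2 - (α : ℤ)) (n : ℤ) = 1 ∧
        (α : ℤ) ≡ r [ZMOD (Nat.gcd n h : ℤ)]),
    jacobiSym (α : ℤ) n

/-- The local factor at `p` of the constant `P(r,h)`; it is `1` unless `p` is an odd prime. -/
noncomputable def Pfac (r : ℤ) (h : ℕ) (p : ℕ) : ℝ :=
  if p.Prime ∧ p ≠ 2 then
    if p ∣ h then
      ((p : ℝ) / ((p : ℝ) - (jacobiSym r p : ℝ))) *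
        (if ¬ (p ^ 2 ∣ h) ∧ (p : ℤ) ∣ r then 1 - 1 / (p : ℝ) else 1)
    else ((p : ℝ) ^ 4 - (p : ℝ) ^ 3 - 2 * (p : ℝ) ^ 2 - (p : ℝ) + 1) /
      ((p : ℝ) * ((p : ℝ) - 1) * ((p : ℝ) ^ 2 - 1))
  else 1

/-- The constant `P(r,h)`. -/
noncomputable def Pconst (r : ℤ) (h : ℕ) : ℝ :=
  (1 / (Nat.totient h : ℝ)) * ∏' p : ℕ, Pfac r h p

/-- The term of the double series defining `C_t`: it is
`μ(d)·c_t(n)/(n·φ([nd²,h]))` when `d` is odd with `(d,t)=1`, `(d²,h) | r`, and `n` is odd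
with `(n,d)=1`, and `0` otherwise (in particular for `d = 0` or `n = 0`). -/
def Cterm (r : ℤ) (h : ℕ) (t : ℤ) (d n : ℕ) : ℝ :=
  if Odd d ∧ Int.gcd (d : ℤ) t = 1 ∧ ((Nat.gcd (d ^ 2) h : ℤ) ∣ r) ∧
      Odd n ∧ Nat.gcd n d = 1 then
    (ArithmeticFunction.moebius d : ℝ) * (cFun r h t n : ℝ) /
      ((n : ℝ) * (Nat.totient (Nat.lcm (n * d ^ 2) h) : ℝ))
  else 0

/-- A multiplicative function is absolutely summable as soon as its sums over powers of primes
exceed `1` by at most a summable amount, dominated by a geometric series. -/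
theorem summable_norm_of_multiplicative {f : ℕ → ℝ} (hf₁ : f 1 = 1) (hf₀ : f 0 = 0)
    (hmul : ∀ {m n : ℕ}, Nat.Coprime m n → f (m * n) = f m * f n)
    {b : ℕ → ℝ} (hb₀ : ∀ p, 0 ≤ b p) (hb : Summable b)
    (hbd : ∀ {p : ℕ}, p.Prime → ∀ k : ℕ, ‖f (p ^ (k + 1))‖ ≤ b p / 2 * (1 / 2) ^ k) :
    Summable fun n => ‖f n‖ := by
  have hgeom : ∀ p, HasSum (fun k : ℕ => b p / 2 * (1 / 2 : ℝ) ^ k) (b p) := fun p => by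
    simpa using hasSum_geometric_two.mul_left (b p / 2)
  have hsum' : ∀ {p : ℕ}, p.Prime → Summable fun k : ℕ => ‖f (p ^ (k + 1))‖ := fun hp =>
    Summable.of_nonneg_of_le (fun _ => norm_nonneg _) (hbd hp) (hgeom _).summable
  have hsum : ∀ {p : ℕ}, p.Prime → Summable fun k : ℕ => ‖f (p ^ k)‖ := fun hp =>
    (summable_nat_add_iff 1).mp (hsum' hp)
  have hle : ∀ {p : ℕ}, p.Prime → ∑' k : ℕ, ‖f (p ^ k)‖ ≤ 1 + b p := fun {p} hp => by
    rw [(hsum hp).tsum_eq_zero_add, pow_zero, hf₁, norm_one, ← (hgeom p).tsum_eq]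
    exact add_le_add_right ((hsum' hp).tsum_le_tsum (hbd hp) (hgeom p).summable) 1
  refine summable_of_sum_range_le (c := Real.exp (∑' p, b p)) (fun n => norm_nonneg _) fun N => ?_
  obtain ⟨h1, h2⟩ := EulerProduct.summable_and_hasSum_smoothNumbers_prod_primesBelow_tsum
    (f := fun n => ‖f n‖) (by simp [hf₁]) (fun h => by simp [hmul h])
    (fun hp => by simpa using hsum hp) N
  have h3 : ∑ n ∈ Finset.range N, ‖f n‖ ≤ ∑' m : N.smoothNumbers, ‖f m‖ := by
    rw [tsum_subtype N.smoothNumbers fun n => ‖f n‖]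
    have hs : Summable (N.smoothNumbers.indicator fun n => ‖f n‖) := by
      rw [← summable_subtype_iff_indicator]; exact h2.summable
    refine le_trans (Finset.sum_le_sum fun n hn => ?_) (hs.sum_le_tsum (Finset.range N)
      fun n _ => Set.indicator_nonneg (fun _ _ => norm_nonneg _) _)
    rcases Nat.eq_zero_or_pos n with rfl | hn0
    · simp only [hf₀, norm_zero]
      exact Set.indicator_nonneg (fun _ _ => norm_nonneg _) _
    · rw [Set.indicator_of_mem (Nat.mem_smoothNumbers_of_lt hn0 (Finset.mem_range.mp hn))]
  refine h3.trans ?_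
  rw [h2.tsum_eq]
  calc ∏ p ∈ N.primesBelow, ∑' k : ℕ, ‖f (p ^ k)‖
      ≤ ∏ p ∈ N.primesBelow, Real.exp (b p) :=
        Finset.prod_le_prod (fun p _ => tsum_nonneg fun _ => norm_nonneg _) fun p hp =>
          (hle (Nat.prime_of_mem_primesBelow hp)).trans (by
            rw [add_comm]; exact Real.add_one_le_exp _)
    _ = Real.exp (∑ p ∈ N.primesBelow, b p) := (Real.exp_sum _ _).symm
    _ ≤ _ := Real.exp_le_exp.mpr (hb.sum_le_tsum _ fun p _ => hb₀ p)

/-- The unitary convolution of two multiplicative functions is multiplicative. -/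
theorem unitary_convolution_mul {A B : ℕ → ℝ}
    (hA : ∀ {m n : ℕ}, Nat.Coprime m n → A (m * n) = A m * A n)
    (hB : ∀ {m n : ℕ}, Nat.Coprime m n → B (m * n) = B m * B n)
    {m n : ℕ} (hm : m ≠ 0) (hn : n ≠ 0) (h : Nat.Coprime m n) :
    ∑ d ∈ (m * n).divisors, (if Nat.Coprime d (m * n / d) then A d * B (m * n / d) else 0) =
      (∑ d ∈ m.divisors, if Nat.Coprime d (m / d) then A d * B (m / d) else 0) *
        ∑ d ∈ n.divisors, if Nat.Coprime d (n / d) then A d * B (n / d) else 0 := by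
  rw [Finset.sum_mul_sum, ← Finset.sum_product', Nat.divisors_mul, ← Finset.image_mul_product,
    Finset.sum_image h.mul_injOn_divisors]
  refine Finset.sum_congr rfl fun x hx => ?_
  obtain ⟨⟨a, ha⟩, ⟨c, hc⟩⟩ : x.1 ∣ m ∧ x.2 ∣ n := by
    simpa [hm, hn] using hx
  obtain ⟨d, e⟩ := x
  simp only at ha hc
  subst ha hc
  have hd : 0 < d := Nat.pos_of_ne_zero (left_ne_zero_of_mul hm)
  have he : 0 < e := Nat.pos_of_ne_zero (left_ne_zero_of_mul hn)
  simp only [Nat.mul_div_cancel_left _ hd, Nat.mul_div_cancel_left _ he,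
    mul_mul_mul_comm d a e c, Nat.mul_div_cancel_left _ (Nat.mul_pos hd he)]
  have hde : Nat.Coprime d e := h.coprime_mul_right.coprime_mul_right_right
  have hac : Nat.Coprime a c := h.coprime_mul_left.coprime_mul_left_right
  have hdc : Nat.Coprime d c := h.coprime_mul_right.coprime_mul_left_right
  have hae : Nat.Coprime a e := h.coprime_mul_left.coprime_mul_right_right
  have hiff : Nat.Coprime (d * e) (a * c) ↔ Nat.Coprime d a ∧ Nat.Coprime e c := by
    have hea := hae.symm
    simp only [Nat.coprime_mul_iff_left, Nat.coprime_mul_iff_right]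
    tauto
  rw [hA hde, hB hac, if_congr hiff rfl rfl]
  split_ifs <;> first | (exfalso; tauto) | ring

/-- Euler product for the double series of two multiplicative functions over coprime pairs. -/
theorem hasProd_coprime_pairs {A B : ℕ → ℝ} (hA₁ : A 1 = 1) (hB₁ : B 1 = 1)
    (hA₀ : A 0 = 0) (hB₀ : B 0 = 0)
    (hA : ∀ {m n : ℕ}, Nat.Coprime m n → A (m * n) = A m * A n)
    (hB : ∀ {m n : ℕ}, Nat.Coprime m n → B (m * n) = B m * B n)
    (hAs : Summable fun n => ‖A n‖) (hBs : Summable fun n => ‖B n‖) :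
    Summable (fun x : ℕ × ℕ => if Nat.Coprime x.1 x.2 then A x.1 * B x.2 else 0) ∧
    HasProd (Set.mulIndicator {p : ℕ | p.Prime}
        fun p => ∑' k : ℕ, A (p ^ k) + ∑' k : ℕ, B (p ^ k) - 1)
      (∑' x : ℕ × ℕ, if Nat.Coprime x.1 x.2 then A x.1 * B x.2 else 0) := by
  set Φ : ℕ × ℕ → ℝ := fun x => if Nat.Coprime x.1 x.2 then A x.1 * B x.2 else 0 with hΦ
  have hs : Summable Φ := by
    refine Summable.of_norm_bounded (hAs.mul_of_nonneg hBs (fun _ => norm_nonneg _)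
      fun _ => norm_nonneg _) fun x => ?_
    simp only [hΦ]
    split_ifs
    · exact (norm_mul _ _).le
    · simp only [norm_zero]; positivity
  refine ⟨hs, ?_⟩
  set G : ℕ → ℝ := fun m =>
    ∑' x : ((fun x : ℕ × ℕ => x.1 * x.2) ⁻¹' {m} : Set (ℕ × ℕ)), Φ x with hG
  have hGsum : HasSum G (∑' x, Φ x) := hs.hasSum.tsum_fiberwise _
  have hG₀ : G 0 = 0 := by
    refine (tsum_congr fun x => ?_).trans tsum_zero
    obtain ⟨⟨d, n⟩, hx⟩ := x
    rcases Nat.mul_eq_zero.mp (show d * n = 0 from hx) with rfl | rfl <;> simp [hΦ, hA₀, hB₀]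
  have hGd : ∀ m, m ≠ 0 → G m =
      ∑ d ∈ m.divisors, if Nat.Coprime d (m / d) then A d * B (m / d) else 0 := by
    intro m hm
    have hset : ((fun x : ℕ × ℕ => x.1 * x.2) ⁻¹' {m} : Set (ℕ × ℕ)) =
        (m.divisorsAntidiagonal : Set (ℕ × ℕ)) := by
      ext x; simp [hm]
    simp only [hG]
    rw [hset, Finset.tsum_subtype' m.divisorsAntidiagonal Φ,
      Nat.sum_divisorsAntidiagonal fun a b => if Nat.Coprime a b then A a * B b else 0]
  have hG₁ : G 1 = 1 := by simp [hGd 1 one_ne_zero, hA₁, hB₁]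
  have hGmul : ∀ {m n : ℕ}, Nat.Coprime m n → G (m * n) = G m * G n := by
    intro m n h
    rcases eq_or_ne m 0 with rfl | hm
    · simp [hG₀]
    rcases eq_or_ne n 0 with rfl | hn
    · simp [hG₀]
    rw [hGd _ (mul_ne_zero hm hn), hGd _ hm, hGd _ hn, unitary_convolution_mul hA hB hm hn h]
  have hprod := EulerProduct.eulerProduct_hasProd_mulIndicator hG₁ hGmul hGsum.summable.norm hG₀
  rw [hGsum.tsum_eq] at hprod
  rw [Set.mulIndicator_congr (g := fun p => ∑' k : ℕ, G (p ^ k))]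
  · exact hprod
  intro p hp
  have hp : p.Prime := hp
  have hinj : Function.Injective fun k : ℕ => p ^ k := Nat.pow_right_injective hp.two_le
  have hpow : ∀ k, G (p ^ (k + 1)) = A (p ^ (k + 1)) + B (p ^ (k + 1)) := by
    intro k
    rw [hGd _ (pow_ne_zero _ hp.ne_zero), Nat.sum_divisors_prime_pow hp,
      Finset.sum_range_succ, Finset.sum_range_succ']
    have hmid : ∑ j ∈ Finset.range k, (if Nat.Coprime (p ^ (j + 1)) (p ^ (k + 1) / p ^ (j + 1))
        then A (p ^ (j + 1)) * B (p ^ (k + 1) / p ^ (j + 1)) else 0) = 0 := by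
      refine Finset.sum_eq_zero fun j hj => if_neg ?_
      have hj := Finset.mem_range.mp hj
      rw [Nat.pow_div (by omega) hp.pos, Nat.coprime_pow_left_iff (by omega),
        Nat.coprime_pow_right_iff (by omega), Nat.coprime_self]
      exact hp.one_lt.ne'
    rw [hmid]
    simp [Nat.div_self (pow_pos hp.pos (k + 1)), hA₁, hB₁]
    ring
  have sA := (hAs.of_norm.comp_injective hinj)
  have sB := (hBs.of_norm.comp_injective hinj)
  have sG := (hGsum.summable.comp_injective hinj)
  simp only [Function.comp_def] at sA sB sG
  beta_reduce
  rw [sA.tsum_eq_zero_add, sB.tsum_eq_zero_add, sG.tsum_eq_zero_add]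
  simp only [pow_zero, hA₁, hB₁, hG₁, hpow]
  rw [((summable_nat_add_iff 1).mpr sA).tsum_add ((summable_nat_add_iff 1).mpr sB)]
  ring

/-- The totient function is multiplicative on least common multiples with a fixed number. -/
theorem totient_lcm_mul (h : ℕ) (hpos : 0 < h) {m n : ℕ} (hmn : Nat.Coprime m n) :
    Nat.totient (Nat.lcm (m * n) h) * Nat.totient h =
      Nat.totient (Nat.lcm m h) * Nat.totient (Nat.lcm n h) := by
  have hfac : ∀ x : ℕ, ∃ a, Nat.lcm x h = h * a ∧ a ∣ x := fun x => by
    obtain ⟨a, ha⟩ := Nat.dvd_lcm_right x h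
    refine ⟨a, ha, Nat.dvd_of_mul_dvd_mul_left hpos ?_⟩
    rw [← ha]
    exact Nat.lcm_dvd (dvd_mul_left _ _) (dvd_mul_right _ _)
  have hgcd : Nat.gcd (Nat.lcm m h) (Nat.lcm n h) = h := by
    obtain ⟨a, ha, ham⟩ := hfac m
    obtain ⟨b, hb, hbn⟩ := hfac n
    rw [ha, hb, Nat.gcd_mul_left, (hmn.coprime_dvd_left ham).coprime_dvd_right hbn, mul_one]
  have hlcm : Nat.lcm (Nat.lcm m h) (Nat.lcm n h) = Nat.lcm (m * n) h := by
    rw [← hmn.lcm_eq_mul]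
    simp only [Nat.lcm_assoc, Nat.lcm_comm h, Nat.lcm_self]
  have h1 := Nat.totient_gcd_mul_totient_mul (Nat.lcm m h) (Nat.lcm n h)
  have h2 := Nat.totient_gcd_mul_totient_mul h (Nat.lcm (m * n) h)
  rw [Nat.gcd_eq_left (Nat.dvd_lcm_right _ _)] at h2
  rw [← Nat.gcd_mul_lcm (Nat.lcm m h), hgcd, hlcm, h2] at h1
  rw [mul_comm, Nat.eq_of_mul_eq_mul_right hpos h1]

theorem totient_lcm_of_coprime {h m : ℕ} (hm : Nat.Coprime m h) :
    Nat.totient (Nat.lcm m h) = Nat.totient m * Nat.totient h := by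
  rw [hm.lcm_eq_mul, Nat.totient_mul hm]

theorem totient_prime_pow_mul {p h : ℕ} (hp : p.Prime) (hph : p ∣ h) (j : ℕ) :
    Nat.totient (p ^ j * h) = p ^ j * Nat.totient h := by
  induction j with
  | zero => simp
  | succ j ih =>
    rw [pow_succ', mul_assoc, Nat.totient_mul_of_prime_of_dvd hp (hph.mul_left _), ih, mul_assoc]

theorem gcd_mul_totient_lcm_prime_pow {p h : ℕ} (hp : p.Prime) (hph : p ∣ h) (k : ℕ) :
    Nat.gcd (p ^ k) h * Nat.totient (Nat.lcm (p ^ k) h) = p ^ k * Nat.totient h := by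
  obtain ⟨i, hi, hg⟩ := (Nat.dvd_prime_pow hp).mp (Nat.gcd_dvd_left (p ^ k) h)
  have hl : Nat.lcm (p ^ k) h = p ^ (k - i) * h := by
    have := Nat.gcd_mul_lcm (p ^ k) h
    refine Nat.eq_of_mul_eq_mul_left (pow_pos hp.pos i) ?_
    rw [← mul_assoc, ← pow_add, Nat.add_sub_of_le hi, ← this, hg]
  rw [hg, hl, totient_prime_pow_mul hp hph, ← mul_assoc, ← pow_add, Nat.add_sub_of_le hi]

/-- The summand of `cFun`, extended by zero. -/
def cSummand (r : ℤ) (h : ℕ) (t : ℤ) (n : ℕ) (α : ℤ) : ℤ :=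
  if Int.gcd (t ^ 2 - α) n = 1 ∧ α ≡ r [ZMOD (Nat.gcd n h : ℤ)] then jacobiSym α n else 0

theorem cFun_eq_sum (r : ℤ) (h : ℕ) (t : ℤ) (n : ℕ) :
    cFun r h t n = ∑ α ∈ Finset.range n, cSummand r h t n α := by
  have himage : (Finset.range n >>= fun α => (pure (α : ℤ) : Finset ℤ)) =
      (Finset.range n).image fun α : ℕ => (α : ℤ) := by
    ext; simp [Finset.bind_def, eq_comm]
  rw [cFun, Finset.sum_filter, himage, Finset.sum_image fun x _ y _ hxy => Nat.cast_injective hxy]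
  rfl

theorem cSummand_congr (r : ℤ) (h : ℕ) (t : ℤ) (n : ℕ) {α β : ℤ} (hαβ : α ≡ β [ZMOD n]) :
    cSummand r h t n α = cSummand r h t n β := by
  have h1 : Int.gcd (t ^ 2 - α) n = Int.gcd (t ^ 2 - β) n := by
    have := (Int.ModEq.refl (t ^ 2)).sub hαβ
    rw [← Int.gcd_emod, this.eq, Int.gcd_emod]
  have h2 : α ≡ β [ZMOD (Nat.gcd n h : ℤ)] :=
    hαβ.of_dvd (Int.natCast_dvd_natCast.mpr (Nat.gcd_dvd_left n h))
  simp only [cSummand, h1, jacobiSym.mod_left' hαβ]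
  exact if_congr (and_congr_right fun _ => ⟨h2.symm.trans, h2.trans⟩) rfl rfl

theorem cSummand_mul (r : ℤ) (h : ℕ) (t : ℤ) {m n : ℕ} (hm : m ≠ 0) (hn : n ≠ 0)
    (hmn : Nat.Coprime m n) (α : ℤ) :
    cSummand r h t (m * n) α = cSummand r h t m α * cSummand r h t n α := by
  have h1 : Int.gcd (t ^ 2 - α) (m * n : ℕ) = 1 ↔
      Int.gcd (t ^ 2 - α) m = 1 ∧ Int.gcd (t ^ 2 - α) n = 1 := by
    push_cast
    simp only [← Int.isCoprime_iff_gcd_eq_one, IsCoprime.mul_right_iff]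
  have h2 : α ≡ r [ZMOD (Nat.gcd (m * n) h : ℤ)] ↔
      α ≡ r [ZMOD (Nat.gcd m h : ℤ)] ∧ α ≡ r [ZMOD (Nat.gcd n h : ℤ)] := by
    rw [hmn.mul_gcd, Nat.cast_mul]
    refine (Int.modEq_and_modEq_iff_modEq_mul ?_).symm
    exact hmn.coprime_dvd_left (Nat.gcd_dvd_left m h) |>.coprime_dvd_right (Nat.gcd_dvd_left n h)
  simp only [cSummand, h1, h2, jacobiSym.mul_right' α hm hn]
  split_ifs <;> first | rfl | (exfalso; tauto) | simp

theorem cFun_mul (r : ℤ) (h : ℕ) (t : ℤ) {m n : ℕ} (hm : m ≠ 0) (hn : n ≠ 0)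
    (hmn : Nat.Coprime m n) : cFun r h t (m * n) = cFun r h t m * cFun r h t n := by
  simp only [cFun_eq_sum]
  rw [Finset.sum_mul_sum, ← Finset.sum_product']
  refine Finset.sum_nbij' (fun α => (α % m, α % n))
    (fun x => Nat.chineseRemainder hmn x.1 x.2) ?_ ?_ ?_ ?_ ?_
  · intro α _
    simp [Nat.mod_lt _ (Nat.pos_of_ne_zero hm), Nat.mod_lt _ (Nat.pos_of_ne_zero hn)]
  · intro x _
    exact Finset.mem_range.mpr (Nat.chineseRemainder_lt_mul hmn _ _ hm hn)
  · intro α hα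
    have h1 := Nat.chineseRemainder_modEq_unique hmn (a := α % m) (b := α % n) (z := α)
      (Nat.mod_modEq _ _).symm (Nat.mod_modEq _ _).symm
    exact (h1.symm.eq_of_lt_of_lt (Nat.chineseRemainder_lt_mul hmn _ _ hm hn)
      (Finset.mem_range.mp hα))
  · intro x hx
    obtain ⟨hx1, hx2⟩ := Finset.mem_product.mp hx
    have h1 := (Nat.chineseRemainder hmn x.1 x.2).2
    ext
    · exact Eq.trans h1.1 (Nat.mod_eq_of_lt (Finset.mem_range.mp hx1))
    · exact Eq.trans h1.2 (Nat.mod_eq_of_lt (Finset.mem_range.mp hx2))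
  · intro α _
    rw [cSummand_mul r h t hm hn hmn]
    congr 1 <;> refine cSummand_congr r h t _ ?_ <;> push_cast <;> exact (Int.mod_modEq _ _).symm

theorem sum_range_mul_of_periodic {p : ℕ} {f : ℕ → ℤ} (hf : Function.Periodic f p) (m : ℕ) :
    ∑ α ∈ Finset.range (p * m), f α = m * ∑ α ∈ Finset.range p, f α := by
  induction m with
  | zero => simp
  | succ m ih =>
    rw [mul_add_one, Finset.sum_range_add, ih]
    have : ∀ x, f (p * m + x) = f x := fun x => by
      rw [mul_comm, add_comm]; exact hf.nat_mul m x
    simp only [this]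
    push_cast; ring

theorem sum_range_eq_sum_zmod (p : ℕ) [NeZero p] (f : ZMod p → ℤ) :
    ∑ α ∈ Finset.range p, f α = ∑ x : ZMod p, f x := by
  refine Finset.sum_nbij' (fun α => (α : ZMod p)) ZMod.val ?_ ?_ ?_ ?_ ?_ <;> intro x hx
  · simp
  · simpa using ZMod.val_lt x
  · exact ZMod.val_cast_of_lt (Finset.mem_range.mp hx)
  · simp
  · rfl

/-- At powers of a prime `p ∣ h`, every `α ≡ r` counts, with value `(r|p)^k`. -/
theorem cFun_prime_pow_of_dvd {r : ℤ} {h : ℕ} {t : ℤ} (ht : Int.gcd (t ^ 2 - r) (h : ℤ) = 1)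
    {p : ℕ} (hp : p.Prime) (hph : p ∣ h) {k : ℕ} (hk : k ≠ 0) :
    cFun r h t (p ^ k) * (Nat.gcd (p ^ k) h : ℕ) = jacobiSym r p ^ k * p ^ k := by
  set g := Nat.gcd (p ^ k) h with hg
  have hpg : p ∣ g := Nat.dvd_gcd (dvd_pow_self p hk) hph
  have hg0 : 0 < g := Nat.gcd_pos_of_pos_left _ (pow_pos hp.pos k)
  have : NeZero g := ⟨hg0.ne'⟩
  obtain ⟨m, hm⟩ := Nat.gcd_dvd_left (p ^ k) h
  have hsummand : ∀ α : ℕ, cSummand r h t (p ^ k) α =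
      if (α : ZMod g) = (r : ZMod g) then jacobiSym r p ^ k else 0 := by
    intro α
    have h1 : (α : ℤ) ≡ r [ZMOD g] ↔ (α : ZMod g) = (r : ZMod g) := by
      rw [← ZMod.intCast_eq_intCast_iff]; simp
    simp only [cSummand, ← hg, ← h1]
    by_cases h2 : (α : ℤ) ≡ r [ZMOD g]
    · have h3 : (α : ℤ) ≡ r [ZMOD p] := h2.of_dvd (Int.natCast_dvd_natCast.mpr hpg)
      rw [if_pos h2, if_pos, jacobiSym.pow_right, jacobiSym.mod_left' h3]
      refine ⟨?_, h2⟩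
      rw [← Int.isCoprime_iff_gcd_eq_one, Nat.cast_pow]
      refine IsCoprime.pow_right ?_
      rw [Int.isCoprime_iff_gcd_eq_one, ← Int.gcd_emod, ((Int.ModEq.refl (t ^ 2)).sub h3).eq,
        Int.gcd_emod, ← Int.isCoprime_iff_gcd_eq_one]
      exact (Int.isCoprime_iff_gcd_eq_one.mpr ht).of_isCoprime_of_dvd_right
        (Int.natCast_dvd_natCast.mpr hph)
    · rw [if_neg h2, if_neg fun h => h2 h.2]
  rw [cFun_eq_sum, Finset.sum_congr rfl fun α _ => hsummand α]
  nth_rw 1 [hm]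
  rw [← hg, sum_range_mul_of_periodic (f := fun α : ℕ =>
    if (α : ZMod g) = (r : ZMod g) then jacobiSym r p ^ k else 0) (by intro x; simp),
    sum_range_eq_sum_zmod g fun x => if x = (r : ZMod g) then jacobiSym r p ^ k else 0]
  simp only [Finset.sum_ite_eq', Finset.mem_univ, if_true]
  have : ((p ^ k : ℕ) : ℤ) = g * m := by rw [hm]; push_cast; rfl
  push_cast at this
  rw [this]; ring

/-- At powers of an odd prime `p ∤ h`, the value of `cFun` depends on the parity of the
exponent. -/
theorem cFun_prime_pow_of_not_dvd (r : ℤ) {h : ℕ} (t : ℤ) {p : ℕ} (hp : p.Prime) (hp2 : p ≠ 2)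
    (hph : ¬ p ∣ h) {k : ℕ} (hk : k ≠ 0) :
    cFun r h t (p ^ k) = p ^ (k - 1) *
      ((if Even k then (p : ℤ) - 1 else 0) - if (p : ℤ) ∣ t then 0 else 1) := by
  have : Fact p.Prime := ⟨hp⟩
  have hcop : Nat.gcd (p ^ k) h = 1 :=
    Nat.Coprime.pow_left k ((Nat.Prime.coprime_iff_not_dvd hp).mpr hph)
  have hsummand : ∀ α : ℕ, cSummand r h t (p ^ k) α =
      if (α : ZMod p) = (t : ZMod p) ^ 2 then 0 else quadraticChar (ZMod p) (α : ZMod p) ^ k := by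
    intro α
    have h1 : Int.gcd (t ^ 2 - α) (p ^ k : ℕ) = 1 ↔ ¬ (α : ZMod p) = (t : ZMod p) ^ 2 := by
      rw [← Int.isCoprime_iff_gcd_eq_one, Nat.cast_pow,
        IsCoprime.pow_right_iff (Nat.pos_of_ne_zero hk), isCoprime_comm,
        Prime.coprime_iff_not_dvd (Nat.prime_iff_prime_int.mp hp),
        ← ZMod.intCast_zmod_eq_zero_iff_dvd]
      push_cast
      rw [sub_eq_zero, eq_comm]
    rw [cSummand, hcop, jacobiSym.pow_right, ← jacobiSym.legendreSym.to_jacobiSym]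
    simp only [h1, legendreSym, Nat.cast_one, Int.modEq_one, and_true, Int.cast_natCast]
    split_ifs <;> rfl
  rw [cFun_eq_sum, Finset.sum_congr rfl fun α _ => hsummand α]
  obtain ⟨j, rfl⟩ := Nat.exists_eq_succ_of_ne_zero hk
  rw [Nat.succ_eq_add_one, Nat.add_sub_cancel]
  nth_rw 1 [pow_succ']
  rw [sum_range_mul_of_periodic (f := fun α : ℕ =>
    if (α : ZMod p) = (t : ZMod p) ^ 2 then 0 else quadraticChar (ZMod p) (α : ZMod p) ^ (j + 1))
    (by intro x; simp),
    sum_range_eq_sum_zmod p fun x => if x = (t : ZMod p) ^ 2 then 0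
      else quadraticChar (ZMod p) x ^ (j + 1)]
  push_cast
  congr 1
  have hsplit : ∀ x : ZMod p, (if x = (t : ZMod p) ^ 2 then 0
      else quadraticChar (ZMod p) x ^ (j + 1)) = quadraticChar (ZMod p) x ^ (j + 1) -
        if x = (t : ZMod p) ^ 2 then
          quadraticChar (ZMod p) ((t : ZMod p) ^ 2) ^ (j + 1) else 0 := by
    intro x; split_ifs with hx <;> simp [hx]
  rw [Finset.sum_congr rfl fun x _ => hsplit x, Finset.sum_sub_distrib]
  congr 1
  · split_ifs with he
    · have : ∀ x : ZMod p, quadraticChar (ZMod p) x ^ (j + 1) = 1 - if x = 0 then 1 else 0 := by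
        intro x
        split_ifs with hx
        · simp [hx]
        · rcases quadraticChar_dichotomy hx with h | h <;> simp [h, he.neg_one_pow]
      simp only [this, Finset.sum_sub_distrib]
      simp [ZMod.card]
    · have ho : Odd (j + 1) := Nat.not_even_iff_odd.mp he
      have : ∀ x : ZMod p, quadraticChar (ZMod p) x ^ (j + 1) = quadraticChar (ZMod p) x := by
        intro x
        by_cases hx : x = 0
        · simp [hx]
        · rcases quadraticChar_dichotomy hx with h | h <;> simp [h, ho.neg_one_pow]
      simp only [this]
      exact quadraticChar_sum_zero (by rwa [ZMod.ringChar_zmod_n])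
  · simp only [Finset.sum_ite_eq', Finset.mem_univ, if_true]
    simp only [← ZMod.intCast_zmod_eq_zero_iff_dvd]
    split_ifs with h0
    · simp [h0]
    · rw [quadraticChar_sq_one' h0, one_pow]

/-- The ratio `φ([m,h]) / φ(h)`, a multiplicative function of `m`. -/
def totientRatio (h m : ℕ) : ℝ := (Nat.totient (Nat.lcm m h) : ℝ) / Nat.totient h

theorem totient_cast_pos {h : ℕ} (hpos : 0 < h) : (0 : ℝ) < Nat.totient h :=
  Nat.cast_pos.mpr (Nat.totient_pos.mpr hpos)

theorem totientRatio_one {h : ℕ} (hpos : 0 < h) : totientRatio h 1 = 1 := by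
  rw [totientRatio, Nat.lcm_one_left, div_self (totient_cast_pos hpos).ne']

theorem totientRatio_mul {h : ℕ} (hpos : 0 < h) {m n : ℕ} (hmn : Nat.Coprime m n) :
    totientRatio h (m * n) = totientRatio h m * totientRatio h n := by
  have h0 := (totient_cast_pos hpos).ne'
  rw [totientRatio, totientRatio, totientRatio, div_mul_div_comm,
    div_eq_div_iff h0 (mul_ne_zero h0 h0), ← mul_assoc]
  exact_mod_cast congrArg (· * Nat.totient h) (totient_lcm_mul h hpos hmn)

theorem one_le_totientRatio {h m : ℕ} (hpos : 0 < h) (hm : m ≠ 0) : 1 ≤ totientRatio h m := by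
  rw [totientRatio, one_le_div (totient_cast_pos hpos), Nat.cast_le]
  exact Nat.le_of_dvd (Nat.totient_pos.mpr (Nat.lcm_pos (Nat.pos_of_ne_zero hm) hpos))
    (Nat.totient_dvd_of_dvd (Nat.dvd_lcm_right m h))

theorem gcd_mul_totientRatio_prime_pow {p h : ℕ} (hpos : 0 < h) (hp : p.Prime) (hph : p ∣ h)
    (k : ℕ) : (Nat.gcd (p ^ k) h : ℝ) * totientRatio h (p ^ k) = (p : ℝ) ^ k := by
  rw [totientRatio, ← mul_div_assoc, div_eq_iff (totient_cast_pos hpos).ne']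
  exact_mod_cast gcd_mul_totient_lcm_prime_pow hp hph k

theorem totientRatio_prime_pow {p h : ℕ} (hpos : 0 < h) (hp : p.Prime) (hph : ¬ p ∣ h) (k : ℕ) :
    totientRatio h (p ^ (k + 1)) = (p : ℝ) ^ k * (p - 1) := by
  rw [totientRatio, totient_lcm_of_coprime
    (Nat.Coprime.pow_left _ ((Nat.Prime.coprime_iff_not_dvd hp).mpr hph)), Nat.cast_mul,
    mul_div_cancel_right₀ _ (totient_cast_pos hpos).ne', Nat.totient_prime_pow_succ hp]
  push_cast [hp.one_le]
  ring

/-- The factor of `Cterm` depending on `d` only. -/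
def dTerm (r : ℤ) (h : ℕ) (t : ℤ) (d : ℕ) : ℝ :=
  if Odd d ∧ Int.gcd (d : ℤ) t = 1 ∧ ((Nat.gcd (d ^ 2) h : ℤ) ∣ r) then
    (ArithmeticFunction.moebius d : ℝ) / totientRatio h (d ^ 2)
  else 0

/-- The factor of `Cterm` depending on `n` only. -/
def nTerm (r : ℤ) (h : ℕ) (t : ℤ) (n : ℕ) : ℝ :=
  if Odd n then (cFun r h t n : ℝ) / (n * totientRatio h n) else 0

theorem cterm_eq {h : ℕ} (hpos : 0 < h) (r t : ℤ) (d n : ℕ) :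
    Cterm r h t d n = 1 / (Nat.totient h : ℝ) *
      if Nat.Coprime d n then dTerm r h t d * nTerm r h t n else 0 := by
  by_cases hc : Nat.Coprime d n
  · have hψ : (Nat.totient (Nat.lcm (n * d ^ 2) h) : ℝ) =
        Nat.totient h * (totientRatio h n * totientRatio h (d ^ 2)) := by
      rw [← totientRatio_mul hpos (hc.symm.pow_right 2), totientRatio,
        mul_div_cancel₀ _ (totient_cast_pos hpos).ne']
    have hc' : Nat.gcd n d = 1 := hc.symm
    simp only [Cterm, dTerm, nTerm, hψ, hc', if_pos hc, and_true]
    by_cases hn : Odd n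
    · simp only [hn, and_true, if_true]
      split_ifs
      · ring
      · simp
    · simp [hn]
  · have hc' : ¬ Nat.gcd n d = 1 := fun h => hc (Nat.Coprime.symm h)
    simp [Cterm, hc, hc']

theorem dTerm_zero (r : ℤ) (h : ℕ) (t : ℤ) : dTerm r h t 0 = 0 := by simp [dTerm]

theorem dTerm_one {h : ℕ} (hpos : 0 < h) (r t : ℤ) : dTerm r h t 1 = 1 := by
  simp [dTerm, totientRatio_one hpos]

theorem dTerm_mul {h : ℕ} (hpos : 0 < h) (r t : ℤ) {m n : ℕ} (hmn : Nat.Coprime m n) :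
    dTerm r h t (m * n) = dTerm r h t m * dTerm r h t n := by
  have hsq : Nat.Coprime (m ^ 2) (n ^ 2) := hmn.pow 2 2
  have h1 : Int.gcd ((m * n : ℕ) : ℤ) t = 1 ↔ Int.gcd (m : ℤ) t = 1 ∧ Int.gcd (n : ℤ) t = 1 := by
    push_cast
    simp only [← Int.isCoprime_iff_gcd_eq_one, IsCoprime.mul_left_iff]
  have h2 : ((Nat.gcd ((m * n) ^ 2) h : ℤ) ∣ r) ↔
      ((Nat.gcd (m ^ 2) h : ℤ) ∣ r) ∧ ((Nat.gcd (n ^ 2) h : ℤ) ∣ r) := by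
    rw [mul_pow, hsq.mul_gcd, Nat.cast_mul]
    refine ⟨fun hd => ⟨(dvd_mul_right _ _).trans hd, (dvd_mul_left _ _).trans hd⟩, fun hd =>
      IsCoprime.mul_dvd (Nat.isCoprime_iff_coprime.mpr ?_) hd.1 hd.2⟩
    exact (hsq.coprime_dvd_left (Nat.gcd_dvd_left _ h)).coprime_dvd_right (Nat.gcd_dvd_left _ h)
  have hiff : (Odd (m * n) ∧ Int.gcd ((m * n : ℕ) : ℤ) t = 1 ∧
        ((Nat.gcd ((m * n) ^ 2) h : ℤ) ∣ r)) ↔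
      (Odd m ∧ Int.gcd (m : ℤ) t = 1 ∧ ((Nat.gcd (m ^ 2) h : ℤ) ∣ r)) ∧
        Odd n ∧ Int.gcd (n : ℤ) t = 1 ∧ ((Nat.gcd (n ^ 2) h : ℤ) ∣ r) := by
    rw [Nat.odd_mul, h1, h2]
    tauto
  simp only [dTerm]
  by_cases hcm : Odd m ∧ Int.gcd (m : ℤ) t = 1 ∧ ((Nat.gcd (m ^ 2) h : ℤ) ∣ r)
  · by_cases hcn : Odd n ∧ Int.gcd (n : ℤ) t = 1 ∧ ((Nat.gcd (n ^ 2) h : ℤ) ∣ r)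
    · rw [if_pos (hiff.mpr ⟨hcm, hcn⟩), if_pos hcm, if_pos hcn, mul_pow m n 2,
        totientRatio_mul hpos hsq,
        ArithmeticFunction.isMultiplicative_moebius.map_mul_of_coprime hmn, Int.cast_mul,
        mul_div_mul_comm]
    · rw [if_neg fun hc => hcn (hiff.mp hc).2, if_neg hcn, mul_zero]
  · rw [if_neg fun hc => hcm (hiff.mp hc).1, if_neg hcm, zero_mul]

theorem nTerm_zero (r : ℤ) (h : ℕ) (t : ℤ) : nTerm r h t 0 = 0 := by simp [nTerm]

theorem nTerm_one {h : ℕ} (hpos : 0 < h) (r t : ℤ) : nTerm r h t 1 = 1 := by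
  simp [nTerm, totientRatio_one hpos, cFun_eq_sum, cSummand, Int.modEq_one]

theorem nTerm_mul {h : ℕ} (hpos : 0 < h) (r t : ℤ) {m n : ℕ} (hmn : Nat.Coprime m n) :
    nTerm r h t (m * n) = nTerm r h t m * nTerm r h t n := by
  by_cases hodd : Odd m ∧ Odd n
  · rw [nTerm, nTerm, nTerm, if_pos (Nat.odd_mul.mpr hodd), if_pos hodd.1, if_pos hodd.2,
      totientRatio_mul hpos hmn, cFun_mul r h t hodd.1.pos.ne' hodd.2.pos.ne' hmn]
    push_cast
    rw [div_mul_div_comm, mul_mul_mul_comm]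
  · rw [nTerm, if_neg (mt Nat.odd_mul.mp hodd), nTerm, nTerm]
    split_ifs <;> first | (exfalso; tauto) | simp

theorem nTerm_two_pow (r : ℤ) (h : ℕ) (t : ℤ) (k : ℕ) : nTerm r h t (2 ^ (k + 1)) = 0 := by
  simp [nTerm, Nat.odd_pow_iff]

theorem nTerm_prime_pow_of_dvd {r : ℤ} {h : ℕ} {t : ℤ} (hpos : 0 < h)
    (ht : Int.gcd (t ^ 2 - r) (h : ℤ) = 1) {p : ℕ} (hp : p.Prime) (hp2 : p ≠ 2) (hph : p ∣ h)
    (k : ℕ) : nTerm r h t (p ^ k) = ((jacobiSym r p : ℝ) / p) ^ k := by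
  rcases eq_or_ne k 0 with rfl | hk
  · simp [nTerm_one hpos]
  have h1 : (cFun r h t (p ^ k) : ℝ) * (Nat.gcd (p ^ k) h : ℕ) =
      (jacobiSym r p : ℝ) ^ k * p ^ k := by
    exact_mod_cast cFun_prime_pow_of_dvd ht hp hph hk
  have h2 := gcd_mul_totientRatio_prime_pow hpos hp hph k
  have h3 : (0 : ℝ) < p ^ k := pow_pos (Nat.cast_pos.mpr hp.pos) k
  have h4 : (Nat.gcd (p ^ k) h : ℝ) ≠ 0 := left_ne_zero_of_mul (h2 ▸ h3.ne')
  have h5 : totientRatio h (p ^ k) ≠ 0 := right_ne_zero_of_mul (h2 ▸ h3.ne')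
  rw [nTerm, if_pos ((hp.odd_of_ne_two hp2).pow), div_pow, Nat.cast_pow,
    div_eq_div_iff (mul_ne_zero h3.ne' h5) h3.ne']
  refine mul_right_cancel₀ h4 ?_
  linear_combination (p : ℝ) ^ k * h1 - (jacobiSym r p : ℝ) ^ k * p ^ k * h2

theorem nTerm_prime_pow_of_not_dvd (r : ℤ) {h : ℕ} (t : ℤ) (hpos : 0 < h) {p : ℕ} (hp : p.Prime)
    (hp2 : p ≠ 2) (hph : ¬ p ∣ h) (k : ℕ) :
    nTerm r h t (p ^ (k + 1)) =
      ((if Even (k + 1) then (p : ℝ) - 1 else 0) - if (p : ℤ) ∣ t then 0 else 1) /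
        (p ^ (k + 1) * (p - 1)) := by
  have h1 : (p : ℝ) ≠ 0 := Nat.cast_ne_zero.mpr hp.ne_zero
  rw [nTerm, if_pos ((hp.odd_of_ne_two hp2).pow), totientRatio_prime_pow hpos hp hph,
    cFun_prime_pow_of_not_dvd r t hp hp2 hph k.succ_ne_zero]
  push_cast
  rw [mul_left_comm, mul_div_mul_left _ _ (pow_ne_zero k h1)]

/-- A summable majorant for the local factors. -/
def localBound (h p : ℕ) : ℝ := 4 / (p : ℝ) ^ 2 + if p ∈ h.divisors then 2 else 0

theorem localBound_nonneg (h p : ℕ) : 0 ≤ localBound h p := by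
  rw [localBound]; positivity

theorem summable_localBound (h : ℕ) : Summable (localBound h) := by
  refine Summable.add ?_ (summable_of_ne_finset_zero (s := h.divisors) fun p hp => if_neg hp)
  simpa [div_eq_mul_inv] using (Real.summable_nat_pow_inv.mpr one_lt_two).mul_left (4 : ℝ)

theorem one_div_mul_sub_one_le {x : ℝ} (hx : 2 ≤ x) : 1 / (x * (x - 1)) ≤ 4 / x ^ 2 / 2 := by
  rw [div_div, div_le_div_iff₀ (by nlinarith) (by positivity)]
  nlinarith

theorem norm_dTerm_prime_pow_le {h : ℕ} (hpos : 0 < h) (r t : ℤ) {p : ℕ} (hp : p.Prime) (k : ℕ) :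
    ‖dTerm r h t (p ^ (k + 1))‖ ≤ localBound h p / 2 * (1 / 2) ^ k := by
  have hrhs : 0 ≤ localBound h p / 2 * (1 / 2) ^ k :=
    mul_nonneg (div_nonneg (localBound_nonneg h p) zero_le_two) (by positivity)
  rw [dTerm]
  split_ifs
  swap
  · simpa using hrhs
  rcases eq_or_ne k 0 with rfl | hk
  · have hψ := one_le_totientRatio hpos (pow_ne_zero 2 hp.ne_zero)
    have hx : (2 : ℝ) ≤ p := by exact_mod_cast hp.two_le
    simp only [zero_add, pow_one, ArithmeticFunction.moebius_apply_prime hp, pow_zero, mul_one,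
      norm_div, Int.cast_neg, Int.cast_one, norm_neg, norm_one, Real.norm_of_nonneg
        (zero_le_one.trans hψ), localBound]
    by_cases hph : p ∣ h
    · rw [if_pos (Nat.mem_divisors.mpr ⟨hph, hpos.ne'⟩)]
      have := div_le_one_of_le₀ hψ (zero_le_one.trans hψ)
      have h4 : (0 : ℝ) ≤ 4 / (p : ℝ) ^ 2 := by positivity
      linarith
    · rw [if_neg fun hd => hph (Nat.dvd_of_mem_divisors hd),
        totientRatio_prime_pow hpos hp hph, add_zero, pow_one]
      exact one_div_mul_sub_one_le hx
  · rw [ArithmeticFunction.moebius_apply_prime_pow hp k.succ_ne_zero, if_neg (by omega)]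
    simpa using hrhs

theorem norm_nTerm_prime_pow_le {r : ℤ} {h : ℕ} {t : ℤ} (hpos : 0 < h)
    (ht : Int.gcd (t ^ 2 - r) (h : ℤ) = 1) {p : ℕ} (hp : p.Prime) (k : ℕ) :
    ‖nTerm r h t (p ^ (k + 1))‖ ≤ localBound h p / 2 * (1 / 2) ^ k := by
  have hx : (2 : ℝ) ≤ p := by exact_mod_cast hp.two_le
  have hx0 : (0 : ℝ) < p := by linarith
  have h4 : (0 : ℝ) ≤ 4 / (p : ℝ) ^ 2 := by positivity
  have hhalf : (1 : ℝ) / p ≤ 1 / 2 := one_div_le_one_div_of_le two_pos hx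
  rcases eq_or_ne p 2 with rfl | hp2
  · rw [nTerm_two_pow, norm_zero]
    exact mul_nonneg (div_nonneg (localBound_nonneg h 2) zero_le_two) (by positivity)
  by_cases hph : p ∣ h
  · rw [nTerm_prime_pow_of_dvd hpos ht hp hp2 hph, norm_pow]
    have hχ : ‖(jacobiSym r p : ℝ) / p‖ ≤ 1 / 2 := by
      rw [norm_div, Real.norm_of_nonneg hx0.le]
      refine le_trans (div_le_div_of_nonneg_right ?_ hx0.le) hhalf
      rcases jacobiSym.trichotomy r p with h0 | h0 | h0 <;> simp [h0]
    calc ‖(jacobiSym r p : ℝ) / p‖ ^ (k + 1) ≤ (1 / 2) ^ (k + 1) :=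
          pow_le_pow_left₀ (norm_nonneg _) hχ _
      _ = 1 / 2 * (1 / 2) ^ k := pow_succ' _ _
      _ ≤ _ := by
          refine mul_le_mul_of_nonneg_right ?_ (by positivity)
          rw [localBound, if_pos (Nat.mem_divisors.mpr ⟨hph, hpos.ne'⟩)]
          linarith
  rw [nTerm_prime_pow_of_not_dvd r t hpos hp hp2 hph, localBound,
    if_neg fun hd => hph (Nat.dvd_of_mem_divisors hd), add_zero, norm_div, norm_mul, norm_pow,
    Real.norm_of_nonneg hx0.le, Real.norm_of_nonneg (by linarith : (0 : ℝ) ≤ p - 1)]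
  have hden : (0 : ℝ) < p - 1 := by linarith
  rcases Nat.eq_zero_or_pos k with rfl | hk
  · simp only [zero_add, pow_one, pow_zero, mul_one, Nat.not_even_one, if_false]
    refine le_trans (div_le_div_of_nonneg_right ?_ (by positivity)) (one_div_mul_sub_one_le hx)
    split_ifs <;> simp
  · obtain ⟨j, rfl⟩ := Nat.exists_eq_add_of_lt hk
    have hnum : ‖(if Even (0 + j + 1 + 1) then (p : ℝ) - 1 else 0) -
        if (p : ℤ) ∣ t then 0 else 1‖ ≤ p - 1 := by
      rw [Real.norm_eq_abs, abs_le]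
      split_ifs <;> constructor <;> linarith
    refine (div_le_div_of_nonneg_right hnum (by positivity)).trans ?_
    have hj : (1 / (p : ℝ)) ^ j ≤ (1 / 2) ^ j := pow_le_pow_left₀ (by positivity) hhalf j
    calc ((p : ℝ) - 1) / (p ^ (0 + j + 1 + 1) * (p - 1)) = 1 / p ^ 2 * (1 / p) ^ j := by
          rw [one_div_pow]; field_simp; ring
      _ ≤ 1 / p ^ 2 * (1 / 2) ^ j := mul_le_mul_of_nonneg_left hj (by positivity)
      _ = _ := by rw [zero_add, pow_succ]; ring

theorem hasSum_nTerm_prime_pow_of_not_dvd (r : ℤ) {h : ℕ} (t : ℤ) (hpos : 0 < h) {p : ℕ}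
    (hp : p.Prime) (hp2 : p ≠ 2) (hph : ¬ p ∣ h) :
    HasSum (fun k => nTerm r h t (p ^ (k + 1)))
      (1 / ((p : ℝ) ^ 2 - 1) - (if (p : ℤ) ∣ t then 0 else 1) / ((p : ℝ) - 1) ^ 2) := by
  have hx : (2 : ℝ) ≤ p := by exact_mod_cast hp.two_le
  have hx0 : (0 : ℝ) < p := by linarith
  have hx1 : (p : ℝ) - 1 ≠ 0 := by linarith
  have hx2 : (p : ℝ) + 1 ≠ 0 := by linarith
  have hx3 : (p : ℝ) ^ 2 - 1 ≠ 0 := by nlinarith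
  have hlt : |1 / (p : ℝ)| < 1 := by
    rw [abs_of_pos (by positivity), div_lt_one hx0]; linarith
  set e : ℝ := if (p : ℤ) ∣ t then 0 else 1 with he
  have g1 := hasSum_geometric_of_abs_lt_one hlt
  have g2 := hasSum_geometric_of_abs_lt_one (r := -(1 / (p : ℝ))) (by rwa [abs_neg])
  have key := (g1.mul_left (1 / (2 * p) - e / (p * (p - 1)))).sub (g2.mul_left (1 / (2 * (p : ℝ))))
  have hterm : ∀ k, nTerm r h t (p ^ (k + 1)) =
      (1 / (2 * p) - e / (p * (p - 1))) * (1 / (p : ℝ)) ^ k -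
        1 / (2 * p) * (-(1 / (p : ℝ))) ^ k := by
    intro k
    rw [nTerm_prime_pow_of_not_dvd r t hpos hp hp2 hph, ← he, neg_pow (1 / (p : ℝ)), one_div_pow]
    rcases Nat.even_or_odd k with hk | hk
    · rw [if_neg (by simpa using hk.add_one), hk.neg_one_pow]
      field_simp
      ring
    · rw [if_pos hk.add_one, hk.neg_one_pow]
      field_simp
      ring
  have hval : 1 / ((p : ℝ) ^ 2 - 1) - e / ((p : ℝ) - 1) ^ 2 =
      (1 / (2 * p) - e / (p * (p - 1))) * (1 - 1 / (p : ℝ))⁻¹ -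
        1 / (2 * p) * (1 - -(1 / (p : ℝ)))⁻¹ := by
    have i1 : (1 - 1 / (p : ℝ))⁻¹ = p / (p - 1) := by rw [one_sub_div hx0.ne', inv_div]
    have i2 : (1 - -(1 / (p : ℝ)))⁻¹ = p / (p + 1) := by
      rw [sub_neg_eq_add, one_add_div hx0.ne', inv_div]
    have i3 : (p : ℝ) ^ 2 - 1 = (p - 1) * (p + 1) := by ring
    rw [i1, i2, i3]
    field_simp
    ring
  simp only [hval, hterm]
  exact key

theorem tsum_dTerm_prime_pow {h : ℕ} (hpos : 0 < h) (r t : ℤ) {p : ℕ} (hp : p.Prime) :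
    ∑' k, dTerm r h t (p ^ k) = 1 + dTerm r h t p := by
  rw [tsum_eq_sum (s := Finset.range 2) fun k hk => ?_]
  · simp [Finset.sum_range_succ, dTerm_one hpos]
  · have hk2 : ¬ k < 2 := mt Finset.mem_range.mpr hk
    have hμ : ArithmeticFunction.moebius (p ^ k) = 0 := by
      rw [ArithmeticFunction.moebius_apply_prime_pow hp (by omega), if_neg (by omega)]
    simp [dTerm, hμ]

theorem dTerm_two (r : ℤ) (h : ℕ) (t : ℤ) : dTerm r h t 2 = 0 := by
  simp [dTerm, Nat.not_odd_iff_even]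

theorem dTerm_prime_of_not_dvd {h : ℕ} (hpos : 0 < h) (r t : ℤ) {p : ℕ} (hp : p.Prime)
    (hp2 : p ≠ 2) (hph : ¬ p ∣ h) :
    dTerm r h t p = -(if (p : ℤ) ∣ t then 0 else 1) / (p * ((p : ℝ) - 1)) := by
  have h1 : Nat.gcd (p ^ 2) h = 1 :=
    Nat.Coprime.pow_left 2 ((Nat.Prime.coprime_iff_not_dvd hp).mpr hph)
  have h2 : Int.gcd (p : ℤ) t = 1 ↔ ¬ (p : ℤ) ∣ t := by
    rw [← Int.isCoprime_iff_gcd_eq_one, Prime.coprime_iff_not_dvd (Nat.prime_iff_prime_int.mp hp)]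
  simp only [dTerm, h1, h2, hp.odd_of_ne_two hp2, Nat.cast_one, one_dvd, and_true, true_and,
    ArithmeticFunction.moebius_apply_prime hp, totientRatio_prime_pow hpos hp hph, pow_one]
  split_ifs <;> simp

theorem dTerm_prime_of_dvd {h : ℕ} (hpos : 0 < h) {r t : ℤ}
    (hsf : Squarefree (Int.gcd r (h : ℤ))) (ht : Int.gcd (t ^ 2 - r) (h : ℤ) = 1)
    {p : ℕ} (hp : p.Prime) (hp2 : p ≠ 2) (hph : p ∣ h) :
    dTerm r h t p = if ¬ (p ^ 2 ∣ h) ∧ (p : ℤ) ∣ r then -(1 / (p : ℝ)) else 0 := by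
  have hpZ := Nat.prime_iff_prime_int.mp hp
  have hp0 : (p : ℝ) ≠ 0 := Nat.cast_ne_zero.mpr hp.ne_zero
  by_cases hsq : p ^ 2 ∣ h
  · have hg : Nat.gcd (p ^ 2) h = p ^ 2 := Nat.gcd_eq_left hsq
    have hr : ¬ ((p ^ 2 : ℕ) : ℤ) ∣ r := fun hr => by
      have hd : p ^ 2 ∣ Int.gcd r h := by
        exact_mod_cast Int.dvd_gcd hr (Int.natCast_dvd_natCast.mpr hsq)
      exact hp.not_isUnit (hsf p (by rwa [← sq]))
    rw [dTerm, hg, if_neg fun hc => hr hc.2.2, if_neg fun hc => hc.1 hsq]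
  · have hg : Nat.gcd (p ^ 2) h = p := by
      obtain ⟨i, hi, hgi⟩ := (Nat.dvd_prime_pow hp).mp (Nat.gcd_dvd_left (p ^ 2) h)
      have hpg : p ∣ Nat.gcd (p ^ 2) h := Nat.dvd_gcd (dvd_pow_self p two_ne_zero) hph
      interval_cases i
      · rw [hgi, pow_zero] at hpg
        exact absurd (Nat.dvd_one.mp hpg) hp.one_lt.ne'
      · rw [hgi, pow_one]
      · exact absurd (hgi ▸ Nat.gcd_dvd_right (p ^ 2) h) hsq
    have hψ : totientRatio h (p ^ 2) = p := by
      have h1 := gcd_mul_totientRatio_prime_pow hpos hp hph 2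
      rw [hg] at h1
      exact mul_left_cancel₀ hp0 (h1.trans (sq _))
    have hcop : (p : ℤ) ∣ r → Int.gcd (p : ℤ) t = 1 := fun hr => by
      rw [← Int.isCoprime_iff_gcd_eq_one, Prime.coprime_iff_not_dvd hpZ]
      intro hpt
      have hd : p ∣ Int.gcd (t ^ 2 - r) h := by
        exact_mod_cast Int.dvd_gcd ((hpt.pow two_ne_zero).sub hr)
          (Int.natCast_dvd_natCast.mpr hph)
      rw [ht] at hd
      exact hp.one_lt.ne' (Nat.dvd_one.mp hd)
    simp only [dTerm, hg, hψ, hp.odd_of_ne_two hp2, hsq, not_false_eq_true, true_and,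
      ArithmeticFunction.moebius_apply_prime hp]
    by_cases hr : (p : ℤ) ∣ r
    · rw [if_pos ⟨hcop hr, hr⟩, if_pos hr]
      push_cast; ring
    · rw [if_neg fun hc => hr hc.2, if_neg hr]

/-- The correction to the local factor at odd primes dividing `t` but not `h`. -/
def tfac (t : ℤ) (h : ℕ) (p : ℕ) : ℝ :=
  if p.Prime ∧ p ≠ 2 ∧ (p : ℤ) ∣ t ∧ ¬ p ∣ h then
    1 + (2 * (p : ℝ) ^ 2 + (p : ℝ) - 1) /
      ((p : ℝ) ^ 4 - (p : ℝ) ^ 3 - 2 * (p : ℝ) ^ 2 - (p : ℝ) + 1)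
  else 1

theorem three_le_cast {p : ℕ} (hp : p.Prime) (hp2 : p ≠ 2) : (3 : ℝ) ≤ p := by
  exact_mod_cast lt_of_le_of_ne hp.two_le hp2.symm

theorem quartic_lower_bound {x : ℝ} (hx : 3 ≤ x) :
    x ^ 2 * (2 * x ^ 2 + x - 1) ≤ 8 * (x ^ 4 - x ^ 3 - 2 * x ^ 2 - x + 1) ∧
      0 < x ^ 4 - x ^ 3 - 2 * x ^ 2 - x + 1 := by
  obtain ⟨y, rfl⟩ : ∃ y, x = y + 3 := ⟨x - 3, by ring⟩
  have hy : 0 ≤ y := by linarith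
  constructor
  · rw [← sub_nonneg]
    ring_nf
    positivity
  · ring_nf
    positivity

theorem local_factor {r : ℤ} {h : ℕ} {t : ℤ} (hpos : 0 < h)
    (hsf : Squarefree (Int.gcd r (h : ℤ))) (ht : Int.gcd (t ^ 2 - r) (h : ℤ) = 1)
    {p : ℕ} (hp : p.Prime) (hns : Summable fun k => nTerm r h t (p ^ k)) :
    ∑' k, dTerm r h t (p ^ k) + ∑' k, nTerm r h t (p ^ k) - 1 = Pfac r h p * tfac t h p := by
  rw [tsum_dTerm_prime_pow hpos r t hp]
  rcases eq_or_ne p 2 with rfl | hp2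
  · rw [hns.tsum_eq_zero_add]
    simp [nTerm_two_pow, nTerm_one hpos, dTerm_two, Pfac, tfac]
  have hx := three_le_cast hp hp2
  have hx0 : (0 : ℝ) < p := by linarith
  by_cases hph : p ∣ h
  · have hχ : |(jacobiSym r p : ℝ) / p| < 1 := by
      rw [abs_div, abs_of_pos hx0, div_lt_one hx0]
      refine lt_of_le_of_lt ?_ (by linarith : (1 : ℝ) < p)
      rcases jacobiSym.trichotomy r p with h0 | h0 | h0 <;> simp [h0]
    have hP : (p : ℝ) / (p - jacobiSym r p) = (1 - (jacobiSym r p : ℝ) / p)⁻¹ := by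
      rw [one_sub_div hx0.ne', inv_div]
    simp only [nTerm_prime_pow_of_dvd hpos ht hp hp2 hph, tsum_geometric_of_abs_lt_one hχ,
      dTerm_prime_of_dvd hpos hsf ht hp hp2 hph, Pfac, tfac, hp, hp2, hph, hP, ne_eq,
      not_false_eq_true, not_true_eq_false, and_false, and_true, if_true, if_false]
    by_cases hc : ¬ (p ^ 2 ∣ h) ∧ (p : ℤ) ∣ r
    · have hχ0 : jacobiSym r p = 0 := by
        rw [jacobiSym.eq_zero_iff]
        refine ⟨hp.ne_zero, fun hg => hp.one_lt.ne' (Nat.dvd_one.mp ?_)⟩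
        rw [← hg]
        exact_mod_cast Int.dvd_gcd hc.2 (dvd_refl (p : ℤ))
      rw [if_pos hc, if_pos hc, hχ0]
      simp
      ring
    · rw [if_neg hc, if_neg hc]
      ring
  · rw [hns.tsum_eq_zero_add, (hasSum_nTerm_prime_pow_of_not_dvd r t hpos hp hp2 hph).tsum_eq,
      dTerm_prime_of_not_dvd hpos r t hp hp2 hph, pow_zero, nTerm_one hpos]
    have h1 : (p : ℝ) - 1 ≠ 0 := by linarith
    have h2 : (p : ℝ) + 1 ≠ 0 := by linarith
    have h3 : (p : ℝ) ^ 2 - 1 = (p - 1) * (p + 1) := by ring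
    have h4 := (quartic_lower_bound hx).2.ne'
    simp only [Pfac, tfac, hp, hp2, hph, ne_eq, not_false_eq_true, and_true, true_and, if_true,
      if_false, h3]
    split_ifs
    · rw [one_add_div h4, div_mul_div_comm, mul_comm (_ * _) ((p : ℝ) ^ 4 - _ - _ - _ + 1),
        mul_comm ((p : ℝ) ^ 4 - _ - _ - _ + 1) (_ + _), mul_comm _ ((p : ℝ) ^ 4 - _ - _ - _ + 1),
        mul_div_mul_left _ _ h4]
      field_simp
      ring
    · field_simp
      ring

theorem multipliable_tfac (t : ℤ) (h : ℕ) : Multipliable (tfac t h) := by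
  have hs : Summable fun p : ℕ => tfac t h p - 1 := by
    refine Summable.of_norm_bounded (g := fun p : ℕ => 8 * ((p : ℝ) ^ 2)⁻¹)
      ((Real.summable_nat_pow_inv.mpr one_lt_two).mul_left 8) fun p => ?_
    rw [tfac]
    split_ifs with hc
    · have hx := three_le_cast hc.1 hc.2.1
      obtain ⟨h1, h2⟩ := quartic_lower_bound hx
      rw [add_sub_cancel_left, Real.norm_of_nonneg (div_nonneg (by nlinarith) h2.le),
        ← div_eq_mul_inv, div_le_div_iff₀ h2 (by positivity)]
      linarith
    · rw [sub_self, norm_zero]; positivity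
  simpa using Real.multipliable_one_add_of_summable hs

theorem multipliable_pfac (r : ℤ) {h : ℕ} (hpos : 0 < h) : Multipliable (Pfac r h) := by
  have hs : Summable fun p : ℕ => Pfac r h p - 1 := by
    refine Summable.of_norm_bounded_eventually (g := fun p : ℕ => 4 * ((p : ℝ) ^ 2)⁻¹)
      ((Real.summable_nat_pow_inv.mpr one_lt_two).mul_left 4) ?_
    have hfin : ∀ᶠ p in Filter.cofinite, p ∉ h.divisors :=
      h.divisors.finite_toSet.eventually_cofinite_notMem
    filter_upwards [hfin] with p hp
    have hph : ¬ p ∣ h := fun hd => hp (Nat.mem_divisors.mpr ⟨hd, hpos.ne'⟩)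
    rw [Pfac, if_neg hph]
    split_ifs with hc
    · have hx := three_le_cast hc.1 hc.2
      have hx1 : (0 : ℝ) < p - 1 := by linarith
      have hx2 : (0 : ℝ) < (p : ℝ) ^ 2 - 1 := by nlinarith
      have hden : 0 < (p : ℝ) * (p - 1) * (p ^ 2 - 1) := by positivity
      rw [div_sub_one hden.ne', norm_div, Real.norm_of_nonneg hden.le, ← div_eq_mul_inv,
        div_le_div_iff₀ hden (by positivity), Real.norm_eq_abs, abs_of_nonpos (by nlinarith)]
      obtain ⟨y, hy⟩ : ∃ y, (p : ℝ) = y + 3 := ⟨p - 3, by ring⟩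
      have hy0 : 0 ≤ y := by linarith
      rw [hy, ← sub_nonneg]
      ring_nf
      positivity
    · rw [sub_self, norm_zero]; positivity
  simpa using Real.multipliable_one_add_of_summable hs

/-- the Euler product expression for the constant
`C_t = Σ_d μ(d) Σ_n c_t(n)/(n·φ([nd²,h]))`. -/
theorem stmt9 (h : ℕ) (hpos : 0 < h) (hodd : Odd h) (r : ℤ)
    (hsf : Squarefree (Int.gcd r (h : ℤ))) (t : ℤ)
    (ht : Int.gcd (t ^ 2 - r) (h : ℤ) = 1) :
    (∀ d : ℕ, Summable (fun n : ℕ => |Cterm r h t d n|)) ∧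
    Summable (fun d : ℕ => |∑' n : ℕ, Cterm r h t d n|) ∧
    (∑' d : ℕ, ∑' n : ℕ, Cterm r h t d n) =
      Pconst r h *
        ∏' p : ℕ,
          (if p.Prime ∧ p ≠ 2 ∧ (p : ℤ) ∣ t ∧ ¬ p ∣ h then
            1 + (2 * (p : ℝ) ^ 2 + (p : ℝ) - 1) /
              ((p : ℝ) ^ 4 - (p : ℝ) ^ 3 - 2 * (p : ℝ) ^ 2 - (p : ℝ) + 1)
          else 1) := by
  have hsd : Summable fun n => ‖dTerm r h t n‖ :=
    summable_norm_of_multiplicative (dTerm_one hpos r t) (dTerm_zero r h t) (dTerm_mul hpos r t)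
      (localBound_nonneg h) (summable_localBound h) (norm_dTerm_prime_pow_le hpos r t)
  have hsn : Summable fun n => ‖nTerm r h t n‖ :=
    summable_norm_of_multiplicative (nTerm_one hpos r t) (nTerm_zero r h t) (nTerm_mul hpos r t)
      (localBound_nonneg h) (summable_localBound h) (norm_nTerm_prime_pow_le hpos ht)
  obtain ⟨hpairs, hprod⟩ := hasProd_coprime_pairs (dTerm_one hpos r t) (nTerm_one hpos r t)
    (dTerm_zero r h t) (nTerm_zero r h t) (dTerm_mul hpos r t) (nTerm_mul hpos r t) hsd hsn
  have hs : Summable fun x : ℕ × ℕ => Cterm r h t x.1 x.2 := by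
    simp only [cterm_eq hpos]
    exact hpairs.mul_left _
  refine ⟨fun d => (hs.prod_factor d).abs, hs.prod.abs, ?_⟩
  rw [← hs.tsum_prod]
  simp only [cterm_eq hpos]
  rw [tsum_mul_left, ← hprod.tprod_eq, Pconst, mul_assoc]
  congr 1
  refine Eq.trans ?_ ((multipliable_pfac r hpos).tprod_mul (multipliable_tfac t h))
  refine tprod_congr fun p => ?_
  by_cases hp : p.Prime
  · rw [Set.mulIndicator_of_mem (show p ∈ {p : ℕ | p.Prime} from hp)]
    exact local_factor hpos hsf ht hp
      (hsn.of_norm.comp_injective (Nat.pow_right_injective hp.two_le))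
  · rw [Set.mulIndicator_of_notMem (show p ∉ {p : ℕ | p.Prime} from hp)]
    simp [Pfac, hp]
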